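/- Let (O, 𝔉, μ) be a finite measure space, m ∈ [0,1] and ε > 0. For every real-valued, square-integrable measurable function v on O, the functions ψ∘v and ψ^ε∘v are integrable and 0 ≤ ∫_O ψ(v) dμ − ∫_O ψ^ε(v) dμ ≤ ε·( μ(O) + ∫_O v² dμ ). -/

import Mathlib

open MeasureTheory

/-- `ψ(r) = |r|^(m+1)/(m+1)`. -/
noncomputable def psi (m : ℝ) (r : ℝ) : ℝ := |r| ^ (m + 1) / (m + 1)

/-- The Moreau–Yosida approximation `ψ^ε(r) = inf_s [(r−s)²/(2ε) + ψ(s)]`. -/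
noncomputable def psiMY (m ε : ℝ) (r : ℝ) : ℝ :=
  ⨅ s : ℝ, ((r - s) ^ 2 / (2 * ε) + psi m s)

lemma rpow_le_one_add_sq {a p : ℝ} (ha : 0 ≤ a) (hp : 0 ≤ p) (hp2 : p ≤ 2) :
    a ^ p ≤ 1 + a ^ 2 := by
  rcases le_total a 1 with h | h
  · nlinarith [Real.rpow_le_one ha h hp]
  · have := Real.rpow_le_rpow_of_exponent_le h hp2
    rw [Real.rpow_two] at this
    linarith

lemma psi_nonneg {m : ℝ} (hm : 0 ≤ m) (r : ℝ) : 0 ≤ psi m r := by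
  unfold psi
  positivity

lemma psi_le_one_add_sq {m : ℝ} (hm : m ∈ Set.Icc (0 : ℝ) 1) (r : ℝ) : psi m r ≤ 1 + r ^ 2 := by
  have h := rpow_le_one_add_sq (abs_nonneg r) (p := m + 1) (by linarith [hm.1]) (by linarith [hm.2])
  rw [sq_abs] at h
  exact (div_le_self (by positivity) (by linarith [hm.1])).trans h

lemma continuous_psi {m : ℝ} (hm : 0 ≤ m) : Continuous (psi m) := by
  unfold psi
  exact (continuous_abs.rpow_const fun _ => Or.inr (by linarith)).div_const _

/-- The subgradient inequality for `psi`. -/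
lemma psi_sub_psi_le {m : ℝ} (hm : 0 ≤ m) (r s : ℝ) :
    psi m r - psi m s ≤ |r| ^ m * |r - s| := by
  have hm1 : 0 < m + 1 := by linarith
  have ha := abs_nonneg r
  have hb := abs_nonneg s
  have young := Real.geom_mean_le_arith_mean2_weighted (w₁ := m / (m + 1)) (w₂ := 1 / (m + 1))
    (p₁ := |r| ^ (m + 1)) (p₂ := |s| ^ (m + 1)) (by positivity) (by positivity) (by positivity)
    (by positivity) (by field_simp)
  rw [← Real.rpow_mul ha, ← Real.rpow_mul hb, mul_div_cancel₀ _ hm1.ne',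
    mul_div_cancel₀ _ hm1.ne', Real.rpow_one] at young
  have hpow : |r| ^ (m + 1) = |r| ^ m * |r| := by
    rw [Real.rpow_add_of_nonneg ha hm zero_le_one, Real.rpow_one]
  have hmul : |r| ^ m * (|r| - |s|) ≤ |r| ^ m * |r - s| :=
    mul_le_mul_of_nonneg_left (abs_sub_abs_le_abs_sub r s) (by positivity)
  have hsplit : m / (m + 1) * |r| ^ (m + 1) = |r| ^ (m + 1) - |r| ^ (m + 1) / (m + 1) := by
    field_simp
    ring
  have hs : 1 / (m + 1) * |s| ^ (m + 1) = |s| ^ (m + 1) / (m + 1) := by ring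
  unfold psi
  linarith

lemma psiMY_integrand_nonneg {m ε : ℝ} (hm : 0 ≤ m) (hε : 0 < ε) (r s : ℝ) :
    0 ≤ (r - s) ^ 2 / (2 * ε) + psi m s :=
  add_nonneg (by positivity) (psi_nonneg hm s)

lemma bddBelow_psiMY {m ε : ℝ} (hm : 0 ≤ m) (hε : 0 < ε) (r : ℝ) :
    BddBelow (Set.range fun s : ℝ => (r - s) ^ 2 / (2 * ε) + psi m s) :=
  ⟨0, Set.forall_mem_range.2 (psiMY_integrand_nonneg hm hε r)⟩

lemma psiMY_nonneg {m ε : ℝ} (hm : 0 ≤ m) (hε : 0 < ε) (r : ℝ) : 0 ≤ psiMY m ε r :=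
  le_ciInf (psiMY_integrand_nonneg hm hε r)

lemma psiMY_le_psi {m ε : ℝ} (hm : 0 ≤ m) (hε : 0 < ε) (r : ℝ) : psiMY m ε r ≤ psi m r := by
  simpa [psiMY] using ciInf_le (bddBelow_psiMY hm hε r) r

lemma psi_sub_psiMY_le {m ε : ℝ} (hm : m ∈ Set.Icc (0 : ℝ) 1) (hε : 0 < ε) (r : ℝ) :
    psi m r - psiMY m ε r ≤ ε * (1 + r ^ 2) := by
  suffices psi m r - ε * (1 + r ^ 2) ≤ psiMY m ε r by linarith
  refine le_ciInf fun s => ?_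
  have hsub := psi_sub_psi_le hm.1 r s
  have hsq : (|r| ^ m) ^ 2 ≤ 1 + r ^ 2 := by
    have h := rpow_le_one_add_sq (abs_nonneg r) (p := m * 2) (by linarith [hm.1])
      (by linarith [hm.2])
    rwa [Real.rpow_mul (abs_nonneg r), Real.rpow_two, sq_abs] at h
  have hyoung : |r| ^ m * |r - s| ≤ (r - s) ^ 2 / (2 * ε) + ε / 2 * (|r| ^ m) ^ 2 := by
    have h : (r - s) ^ 2 / (2 * ε) + ε / 2 * (|r| ^ m) ^ 2 - |r| ^ m * |r - s| =
        (|r - s| - ε * |r| ^ m) ^ 2 / (2 * ε) := by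
      rw [← sq_abs (r - s)]
      field_simp
      ring
    have : 0 ≤ (|r - s| - ε * |r| ^ m) ^ 2 / (2 * ε) := by positivity
    linarith
  nlinarith [mul_le_mul_of_nonneg_left hsq hε.le, mul_nonneg hε.le (sq_nonneg r)]

lemma measurable_psiMY {m ε : ℝ} (hm : 0 ≤ m) (hε : 0 < ε) : Measurable (psiMY m ε) := by
  refine UpperSemicontinuous.measurable ?_
  refine upperSemicontinuous_ciInf (bddBelow_psiMY hm hε) fun s => ?_
  exact Continuous.upperSemicontinuous (by fun_prop)

theorem stmt_15 {O : Type*} [MeasurableSpace O] (μ : Measure O) [IsFiniteMeasure μ]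
    (m ε : ℝ) (hm : m ∈ Set.Icc (0 : ℝ) 1) (hε : 0 < ε)
    (v : O → ℝ) (hv : Measurable v)
    (hv2 : Integrable (fun x => (v x) ^ 2) μ) :
    Integrable (fun x => psi m (v x)) μ ∧
    Integrable (fun x => psiMY m ε (v x)) μ ∧
    0 ≤ (∫ x, psi m (v x) ∂μ) - ∫ x, psiMY m ε (v x) ∂μ ∧
    (∫ x, psi m (v x) ∂μ) - (∫ x, psiMY m ε (v x) ∂μ) ≤
      ε * ((μ Set.univ).toReal + ∫ x, (v x) ^ 2 ∂μ) := by
  have hdom : Integrable (fun x => 1 + (v x) ^ 2) μ := (integrable_const 1).add hv2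
  have hpsi : Integrable (fun x => psi m (v x)) μ := by
    refine hdom.mono' ((continuous_psi hm.1).measurable.comp hv).aestronglyMeasurable
      (.of_forall fun x => ?_)
    rw [Real.norm_of_nonneg (psi_nonneg hm.1 _)]
    exact psi_le_one_add_sq hm _
  have hpsiMY : Integrable (fun x => psiMY m ε (v x)) μ := by
    refine hpsi.mono' ((measurable_psiMY hm.1 hε).comp hv).aestronglyMeasurable
      (.of_forall fun x => ?_)
    rw [Real.norm_of_nonneg (psiMY_nonneg hm.1 hε _)]
    exact psiMY_le_psi hm.1 hε _
  refine ⟨hpsi, hpsiMY, ?_, ?_⟩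
  · exact sub_nonneg.2 (integral_mono hpsiMY hpsi fun x => psiMY_le_psi hm.1 hε _)
  · have hconst : (μ Set.univ).toReal = ∫ _, (1 : ℝ) ∂μ := by simp [Measure.real]
    rw [← integral_sub hpsi hpsiMY, hconst, ← integral_add (integrable_const 1) hv2,
      ← integral_const_mul]
    exact integral_mono (hpsi.sub hpsiMY) (hdom.const_mul ε) fun x => psi_sub_psiMY_le hm hε _
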